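/- For every positive integer n, the number of ideals of the ring of Gaussian integers ℤ[i] of norm n equals Σ_{d | n} χ(d), where χ is the nontrivial Dirichlet character modulo 4 (χ(d) = 1 if d ≡ 1 mod 4, χ(d) = -1 if d ≡ 3 mod 4, χ(d) = 0 if d even). -/

import Mathlib

open Ideal

section CoprimeNorms

variable {S : Type*} [CommRing S] [IsDedekindDomain S] [Module.Free ℤ S]

theorem Ideal.mul_sup_span_absNorm {I J : Ideal S}
    (h : (absNorm I).Coprime (absNorm J)) : I * J ⊔ span {(absNorm I : S)} = I := by
  apply le_antisymm (sup_le Ideal.mul_le_left (span_singleton_absNorm_le I))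
  have hcop : J ⊔ span {(absNorm I : S)} = ⊤ := by
    rw [Ideal.eq_top_iff_one]
    have hb : (1 : ℤ) = absNorm J * (absNorm I).gcdB (absNorm J) +
        absNorm I * (absNorm I).gcdA (absNorm J) := by
      have := Nat.gcd_eq_gcd_ab (absNorm I) (absNorm J)
      rw [h.gcd_eq_one] at this
      push_cast at this
      linarith
    have hS := congrArg (Int.cast : ℤ → S) hb
    push_cast at hS
    rw [hS]
    exact Submodule.add_mem_sup (Ideal.mul_mem_right _ _ (absNorm_mem J))
      (Ideal.mul_mem_right _ _ (Ideal.mem_span_singleton_self _))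
  calc I = I * (J ⊔ span {(absNorm I : S)}) := by rw [hcop, Ideal.mul_top]
    _ = I * J ⊔ I * span {(absNorm I : S)} := Ideal.mul_sup _ _ _
    _ ≤ _ := sup_le_sup_left Ideal.mul_le_right _

theorem Ideal.sup_span_mul_sup_span {K : Ideal S} {m n : ℕ} (h : m.Coprime n)
    (hK : absNorm K = m * n) : (K ⊔ span {(m : S)}) * (K ⊔ span {(n : S)}) = K := by
  have hmem : ((m * n : ℕ) : S) ∈ K := hK ▸ absNorm_mem K
  apply le_antisymm
  · rw [Ideal.sup_mul, Ideal.mul_sup]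
    refine sup_le (sup_le Ideal.mul_le_left Ideal.mul_le_left) ?_
    rw [Ideal.mul_sup, Ideal.span_singleton_mul_span_singleton]
    refine sup_le Ideal.mul_le_right ?_
    rw [Ideal.span_singleton_le_iff_mem]
    exact_mod_cast hmem
  · intro x hx
    have hb : (1 : ℤ) = m * m.gcdA n + n * m.gcdB n := by
      have := Nat.gcd_eq_gcd_ab m n
      rw [h.gcd_eq_one] at this
      exact_mod_cast this
    have hS := congrArg (Int.cast : ℤ → S) hb
    push_cast at hS
    have hx' : x = (m * m.gcdA n : S) * x + x * (n * m.gcdB n : S) := by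
      linear_combination x * hS
    have hm : (m : S) ∈ K ⊔ span {(m : S)} :=
      Ideal.mem_sup_right (Ideal.mem_span_singleton_self _)
    have hn : (n : S) ∈ K ⊔ span {(n : S)} :=
      Ideal.mem_sup_right (Ideal.mem_span_singleton_self _)
    rw [hx']
    exact Ideal.add_mem _
      (Ideal.mul_mem_mul (Ideal.mul_mem_right _ _ hm) (Ideal.mem_sup_left hx))
      (Ideal.mul_mem_mul (Ideal.mem_sup_left hx) (Ideal.mul_mem_right _ _ hn))

variable [Module.Finite ℤ S]

theorem Ideal.absNorm_sup_span_natCast {K : Ideal S} {m n : ℕ} (h : m.Coprime n)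
    (hK : absNorm K = m * n) : absNorm (K ⊔ span {(m : S)}) = m := by
  have hmul : absNorm (K ⊔ span {(m : S)}) * absNorm (K ⊔ span {(n : S)}) = m * n := by
    rw [← map_mul, sup_span_mul_sup_span h hK, hK]
  have hdvd (k : ℕ) : absNorm (K ⊔ span {(k : S)}) ∣ k ^ Module.finrank ℤ S := by
    rw [← absNorm_span_natCast]
    exact absNorm_dvd_absNorm_of_le le_sup_right
  refine Nat.dvd_antisymm ?_ ?_
  · exact (((h.pow_left _).coprime_dvd_left (hdvd m)).dvd_of_dvd_mul_right
      (hmul ▸ dvd_mul_right _ _))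
  · exact (((h.pow_right _).coprime_dvd_right (hdvd n)).dvd_of_dvd_mul_right
      (hmul ▸ dvd_mul_right _ _))

variable (S) in
/-- For coprime `m` and `n`, an ideal of norm `m * n` factors uniquely into ideals of norms
`m` and `n`. -/
noncomputable def Ideal.absNormMulEquiv {m n : ℕ} (h : m.Coprime n) :
    {I : Ideal S // absNorm I = m} × {J : Ideal S // absNorm J = n} ≃
      {K : Ideal S // absNorm K = m * n} where
  toFun x := ⟨x.1.1 * x.2.1, by rw [map_mul, x.1.2, x.2.2]⟩
  invFun K := (⟨K.1 ⊔ span {(m : S)}, absNorm_sup_span_natCast h K.2⟩,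
    ⟨K.1 ⊔ span {(n : S)}, absNorm_sup_span_natCast h.symm (K.2.trans (mul_comm m n))⟩)
  left_inv := by
    rintro ⟨⟨I, rfl⟩, ⟨J, rfl⟩⟩
    refine Prod.ext (Subtype.ext (mul_sup_span_absNorm h)) (Subtype.ext ?_)
    change I * J ⊔ _ = J
    rw [mul_comm I J]
    exact mul_sup_span_absNorm h.symm
  right_inv K := Subtype.ext (sup_span_mul_sup_span h K.2)

end CoprimeNorms

namespace GaussianInt

/-- The Gaussian integers as a free `ℤ`-module of rank two. -/
def linearEquivProd : GaussianInt ≃ₗ[ℤ] ℤ × ℤ where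
  toFun z := (z.re, z.im)
  invFun z := ⟨z.1, z.2⟩
  left_inv _ := rfl
  right_inv _ := rfl
  map_add' _ _ := rfl
  map_smul' c z := by ext <;> simp

instance : Module.Free ℤ GaussianInt := .of_equiv linearEquivProd.symm

instance : Module.Finite ℤ GaussianInt := .equiv linearEquivProd.symm

theorem finrank_int : Module.finrank ℤ GaussianInt = 2 := by
  simp [linearEquivProd.finrank_eq]

theorem absNorm_span_natCast (n : ℕ) : absNorm (span {(n : GaussianInt)}) = n ^ 2 := by
  rw [Ideal.absNorm_span_natCast, finrank_int]

theorem dvd_span_pow_of_absNorm_eq {I : Ideal GaussianInt} {p k : ℕ} (h : absNorm I = p ^ k) :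
    I ∣ span {(p : GaussianInt)} ^ k := by
  rw [Ideal.dvd_iff_le, Ideal.span_singleton_pow, Ideal.span_singleton_le_iff_mem]
  have := absNorm_mem I
  rw [h] at this
  exact_mod_cast this

/-- A prime `p` not congruent to 3 mod 4 splits as a product of two conjugate ideals of norm `p`. -/
theorem exists_mul_eq_span {p : ℕ} (hp : p.Prime) (h : p % 4 ≠ 3) :
    ∃ x y : ℤ, x ^ 2 + y ^ 2 = p ∧
      span {(⟨x, y⟩ : GaussianInt)} * span {(⟨x, -y⟩ : GaussianInt)} =
        span {(p : GaussianInt)} ∧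
      absNorm (span {(⟨x, y⟩ : GaussianInt)}) = p ∧
      absNorm (span {(⟨x, -y⟩ : GaussianInt)}) = p := by
  have := Fact.mk hp
  obtain ⟨a, b, hab⟩ := Nat.Prime.sq_add_sq h
  have hab' : (a : ℤ) ^ 2 + (b : ℤ) ^ 2 = p := by exact_mod_cast hab
  have hmul : span {(⟨a, b⟩ : GaussianInt)} * span {(⟨a, -b⟩ : GaussianInt)} =
      span {(p : GaussianInt)} := by
    rw [Ideal.span_singleton_mul_span_singleton]
    congr 2
    ext
    · simp
      linarith
    · simp
      ring
  have hne (y : ℤ) (hy : (a : ℤ) ^ 2 + y ^ 2 = p) :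
      absNorm (span {(⟨a, y⟩ : GaussianInt)}) ≠ 1 := by
    intro h1
    rw [absNorm_eq_one_iff, Ideal.span_singleton_eq_top, ← Zsqrtd.norm_eq_one_iff] at h1
    have : Zsqrtd.norm (⟨a, y⟩ : GaussianInt) = p := by
      rw [Zsqrtd.norm_def, ← hy]
      ring
    rw [this, Int.natAbs_natCast] at h1
    exact hp.one_lt.ne' h1
  have hN := congrArg absNorm hmul
  rw [map_mul, absNorm_span_natCast] at hN
  obtain ⟨h1, h2⟩ := (hp.mul_eq_prime_sq_iff (hne b hab') (hne (-b) (by simpa using hab'))).1 hN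
  exact ⟨a, b, hab', hmul, h1, h2⟩

theorem span_ne_span_conj {p : ℕ} (hp : p.Prime) (h : p % 4 = 1) {x y : ℤ}
    (hxy : x ^ 2 + y ^ 2 = p)
    (hmul : span {(⟨x, y⟩ : GaussianInt)} * span {(⟨x, -y⟩ : GaussianInt)} =
      span {(p : GaussianInt)})
    (hN : absNorm (span {(⟨x, y⟩ : GaussianInt)}) = p) :
    span {(⟨x, y⟩ : GaussianInt)} ≠ span {(⟨x, -y⟩ : GaussianInt)} := by
  intro heq
  set P := span {(⟨x, y⟩ : GaussianInt)} with hP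
  have hpP : (p : GaussianInt) ∈ P :=
    Ideal.mul_le_left (hmul ▸ Ideal.mem_span_singleton_self _)
  have hxP : ((2 * x : ℤ) : GaussianInt) ∈ P := by
    have : ((2 * x : ℤ) : GaussianInt) = ⟨x, y⟩ + ⟨x, -y⟩ := by
      ext <;> simp
      ring
    rw [this]
    exact Ideal.add_mem _ (Ideal.mem_span_singleton_self _)
      (heq ▸ Ideal.mem_span_singleton_self _)
  have hpi : Prime (p : ℤ) := Nat.prime_iff_prime_int.1 hp
  have hndvd : ¬ (p : ℤ) ∣ 2 * x := by
    intro hd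
    rcases hpi.dvd_or_dvd hd with h2 | ⟨c, rfl⟩
    · have := Int.le_of_dvd two_pos h2
      have := hp.two_le
      omega
    · have hy : (p : ℤ) ∣ y ^ 2 := ⟨1 - p * c ^ 2, by linear_combination hxy⟩
      obtain ⟨d, rfl⟩ := hpi.dvd_of_dvd_pow hy
      have hd1 : (p : ℤ) * (c ^ 2 + d ^ 2) = 1 := by
        apply mul_left_cancel₀ hpi.ne_zero
        linear_combination hxy
      exact hpi.not_isUnit (IsUnit.of_mul_eq_one _ hd1)
  obtain ⟨u, v, huv⟩ := (hpi.coprime_iff_not_dvd).2 hndvd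
  have h1 : (1 : GaussianInt) ∈ P := by
    have := congrArg (Int.cast : ℤ → GaussianInt) huv
    push_cast at this
    rw [← this]
    refine Ideal.add_mem _ (Ideal.mul_mem_left _ _ hpP) (Ideal.mul_mem_left _ _ ?_)
    simpa using hxP
  rw [absNorm_eq_one_iff.2 ((Ideal.eq_top_iff_one _).2 h1)] at hN
  exact hp.one_lt.ne hN

theorem card_absNorm_eq_two_pow (k : ℕ) :
    Nat.card {I : Ideal GaussianInt // absNorm I = 2 ^ k} = 1 := by
  set P := span {(⟨1, 1⟩ : GaussianInt)} with hP
  have hmul : P ^ 2 = span {((2 : ℕ) : GaussianInt)} := by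
    rw [hP, Ideal.span_singleton_pow, Ideal.span_singleton_eq_span_singleton]
    exact associated_of_dvd_dvd ⟨⟨0, -1⟩, by decide⟩ ⟨⟨0, 1⟩, by decide⟩
  have hN : absNorm P = 2 := by
    have := congrArg absNorm hmul
    rw [map_pow, absNorm_span_natCast] at this
    exact Nat.pow_left_injective two_ne_zero this
  have hprime : Prime P := UniqueFactorizationMonoid.irreducible_iff_prime.1
    (irreducible_of_irreducible_absNorm (hN ▸ Nat.prime_two))
  have key (I : Ideal GaussianInt) (hI : absNorm I = 2 ^ k) : I = P ^ k := by
    have hd := dvd_span_pow_of_absNorm_eq hI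
    rw [← hmul, ← pow_mul, dvd_prime_pow hprime] at hd
    obtain ⟨j, -, hj⟩ := hd
    rw [associated_iff_eq] at hj
    rw [hj, map_pow, hN] at hI
    rw [hj, Nat.pow_right_injective le_rfl hI]
  rw [Nat.card_eq_one_iff_unique]
  exact ⟨⟨fun I J => Subtype.ext ((key I.1 I.2).trans (key J.1 J.2).symm)⟩,
    ⟨P ^ k, by rw [map_pow, hN]⟩⟩

theorem card_absNorm_eq_prime_pow_of_mod_four_eq_three {p : ℕ} (hp : p.Prime) (h : p % 4 = 3)
    (k : ℕ) :
    Nat.card {I : Ideal GaussianInt // absNorm I = p ^ k} = if Even k then 1 else 0 := by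
  have := Fact.mk hp
  set P := span {(p : GaussianInt)} with hP
  have hprime : Prime P := Ideal.prime_span_singleton_iff.2
    (prime_of_nat_prime_of_mod_four_eq_three p h)
  have hN (j : ℕ) : absNorm (P ^ j) = p ^ (2 * j) := by
    rw [map_pow, absNorm_span_natCast, pow_mul]
  have key (I : Ideal GaussianInt) (hI : absNorm I = p ^ k) : ∃ j, I = P ^ j ∧ k = 2 * j := by
    have hd := dvd_span_pow_of_absNorm_eq hI
    rw [dvd_prime_pow hprime] at hd
    obtain ⟨j, -, hj⟩ := hd
    rw [associated_iff_eq] at hj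
    rw [hj, hN] at hI
    exact ⟨j, hj, (Nat.pow_right_injective hp.two_le hI).symm⟩
  split_ifs with hk
  · obtain ⟨j, rfl⟩ := even_iff_exists_two_mul.1 hk
    have key' (I : Ideal GaussianInt) (hI : absNorm I = p ^ (2 * j)) : I = P ^ j := by
      obtain ⟨i, rfl, hi⟩ := key I hI
      rw [Nat.eq_of_mul_eq_mul_left two_pos hi]
    rw [Nat.card_eq_one_iff_unique]
    exact ⟨⟨fun I J => Subtype.ext ((key' I.1 I.2).trans (key' J.1 J.2).symm)⟩, ⟨P ^ j, hN j⟩⟩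
  · have : IsEmpty {I : Ideal GaussianInt // absNorm I = p ^ k} :=
      ⟨fun I => by
        obtain ⟨j, -, hj⟩ := key I.1 I.2
        exact hk (even_iff_exists_two_mul.2 ⟨j, hj⟩)⟩
    exact Nat.card_of_isEmpty

theorem card_absNorm_eq_prime_pow_of_mod_four_eq_one {p : ℕ} (hp : p.Prime) (h : p % 4 = 1)
    (k : ℕ) :
    Nat.card {I : Ideal GaussianInt // absNorm I = p ^ k} = k + 1 := by
  obtain ⟨x, y, hxy, hmul, hNP, hNQ⟩ := exists_mul_eq_span hp (by omega)
  have hne := span_ne_span_conj hp h hxy hmul hNP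
  set P := span {(⟨x, y⟩ : GaussianInt)} with hP
  set Q := span {(⟨x, -y⟩ : GaussianInt)} with hQ
  have hPp : Prime P := UniqueFactorizationMonoid.irreducible_iff_prime.1
    (irreducible_of_irreducible_absNorm (hNP.symm ▸ hp))
  have hQp : Prime Q := UniqueFactorizationMonoid.irreducible_iff_prime.1
    (irreducible_of_irreducible_absNorm (hNQ.symm ▸ hp))
  have hPQ (j : ℕ) : ¬ P ∣ Q ^ j := fun hd =>
    hne (associated_iff_eq.1 (hPp.associated_of_dvd hQp (hPp.dvd_of_dvd_pow hd)))
  let f : Fin (k + 1) → {I : Ideal GaussianInt // absNorm I = p ^ k} := fun a =>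
    ⟨P ^ (a : ℕ) * Q ^ (k - a), by
      rw [map_mul, map_pow, map_pow, hNP, hNQ, ← pow_add, Nat.add_sub_cancel' (by omega)]⟩
  have hf : Function.Bijective f := by
    constructor
    · have aux (a b c d : ℕ) (hab : a < b) : P ^ a * Q ^ c ≠ P ^ b * Q ^ d := by
        intro he
        obtain ⟨e, rfl⟩ := Nat.exists_eq_add_of_lt hab
        rw [add_assoc, pow_add, mul_assoc] at he
        have := mul_left_cancel₀ (pow_ne_zero a hPp.ne_zero) he
        exact hPQ c (this ▸ ((dvd_pow_self P e.succ_ne_zero).mul_right _))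
      intro a b hab
      have hab' := congrArg Subtype.val hab
      rcases lt_trichotomy a b with hlt | heq | hlt
      · exact absurd hab' (aux _ _ _ _ hlt)
      · exact heq
      · exact absurd hab'.symm (aux _ _ _ _ hlt)
    · rintro ⟨I, hI⟩
      have hd := dvd_span_pow_of_absNorm_eq hI
      rw [← hmul, mul_pow] at hd
      obtain ⟨A, B, hA, hB, rfl⟩ := exists_dvd_and_dvd_of_dvd_mul hd
      obtain ⟨a, -, ha⟩ := (dvd_prime_pow hPp k).1 hA
      obtain ⟨b, -, hb⟩ := (dvd_prime_pow hQp k).1 hB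
      rw [associated_iff_eq] at ha hb
      subst ha hb
      rw [map_mul, map_pow, map_pow, hNP, hNQ, ← pow_add] at hI
      have hk : a + b = k := Nat.pow_right_injective hp.two_le hI
      refine ⟨⟨a, by omega⟩, Subtype.ext ?_⟩
      change P ^ a * Q ^ (k - a) = P ^ a * Q ^ b
      rw [← hk, Nat.add_sub_cancel_left]
  rw [← Nat.card_eq_of_bijective f hf, Nat.card_fin]

theorem card_absNorm_eq_prime_pow {p : ℕ} (hp : p.Prime) (k : ℕ) :
    (Nat.card {I : Ideal GaussianInt // absNorm I = p ^ k} : ℤ) =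
      ∑ j ∈ Finset.range (k + 1), ZMod.χ₄ p ^ j := by
  rcases hp.eq_two_or_odd with rfl | hodd
  · have h2 : ZMod.χ₄ ((2 : ℕ) : ZMod 4) = 0 := by decide
    rw [card_absNorm_eq_two_pow, h2, zero_geom_sum]
    simp
  · rcases (by omega : p % 4 = 1 ∨ p % 4 = 3) with h | h
    · rw [card_absNorm_eq_prime_pow_of_mod_four_eq_one hp h, ZMod.χ₄_nat_one_mod_four h]
      simp
    · rw [card_absNorm_eq_prime_pow_of_mod_four_eq_three hp h, ZMod.χ₄_nat_three_mod_four h,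
        neg_one_geom_sum]
      rcases Nat.even_or_odd k with hk | hk <;> simp [hk, Nat.even_add_one]

/-- The character `χ₄` as an arithmetic function. -/
def chiFour : ArithmeticFunction ℤ := ⟨fun n => ZMod.χ₄ n, by simp⟩

theorem isMultiplicative_chiFour : chiFour.IsMultiplicative :=
  ⟨by simp [chiFour], fun {m n} _ => by
    change ZMod.χ₄ (m * n : ℕ) = ZMod.χ₄ m * ZMod.χ₄ n
    rw [Nat.cast_mul, map_mul]⟩

theorem card_absNorm_eq (n : ℕ) (hn : 0 < n) :
    (Nat.card {I : Ideal GaussianInt // absNorm I = n} : ℤ) =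
      ∑ d ∈ n.divisors, ZMod.χ₄ d := by
  have hsum (m : ℕ) : ((ArithmeticFunction.zeta : ArithmeticFunction ℤ) * chiFour) m =
      ∑ d ∈ m.divisors, ZMod.χ₄ d := ArithmeticFunction.coe_zeta_mul_apply
  have hmult : ((ArithmeticFunction.zeta : ArithmeticFunction ℤ) * chiFour).IsMultiplicative :=
    ArithmeticFunction.isMultiplicative_zeta.natCast.mul isMultiplicative_chiFour
  rw [← hsum]
  induction n using Nat.recOnPosPrimePosCoprime with
  | zero => exact absurd hn (lt_irrefl 0)
  | one =>
    rw [hmult.1]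
    simp
  | prime_pow p k hp _ =>
    rw [card_absNorm_eq_prime_pow hp, hsum, Nat.sum_divisors_prime_pow hp]
    simp only [Nat.cast_pow, map_pow]
  | coprime a b ha hb hab iha ihb =>
    rw [hmult.2 hab, ← iha (by omega), ← ihb (by omega),
      ← Nat.card_congr (Ideal.absNormMulEquiv GaussianInt hab), Nat.card_prod, Nat.cast_mul]

end GaussianInt

/-- The number of ideals of `ℤ[i]` of norm `n` (the norm of an ideal being the
cardinality of the quotient) equals `∑_{d ∣ n} χ(d)` for the nontrivial Dirichlet
character `χ` mod 4. -/
theorem stmt_15 (n : ℕ) (hn : 0 < n) :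
    (Nat.card {I : Ideal GaussianInt // Nat.card (GaussianInt ⧸ I) = n} : ℤ) =
      ∑ d ∈ n.divisors,
        (if d % 4 = 1 then (1 : ℤ) else if d % 4 = 3 then -1 else 0) := by
  refine (GaussianInt.card_absNorm_eq n hn).trans (Finset.sum_congr rfl fun d _ => ?_)
  rw [ZMod.χ₄_nat_eq_if_mod_four]
  split_ifs <;> omega
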